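/- arXiv:2311.12813 — 4 statements merged into one kernel-verified Lean document; each statement's English description precedes it below -/
import Mathlib

section
/- Let w^1, …, w^l be kernels with w^r ∈ ℝ^{κ^r × κ^r}, and let E^{(i,j)} ∈ ℝ^{H×W} be the matrix with entry 1 at position (i,j) and 0 elsewhere, with all iterated valid cross-correlations defined. Then for every output position (a,b) of the iterated cross-correlation (w^l * (w^{l−1} * (⋯ * (w^1 * E^{(i,j)})⋯))), if it is NOT the case that both i − κ^1 − ⋯ − κ^l + l ≤ a ≤ i and j − κ^1 − ⋯ − κ^l + l ≤ b ≤ j, then (w^l * (w^{l−1} * (⋯ * (w^1 * E^{(i,j)})⋯)))_{a,b} = 0. -/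
/-!
STATEMENT 3. 0-based indexing: matrices are functions `ℕ → ℕ → ℝ` with
relevant entries at `p < H`, `q < W`; the valid cross-correlation
`(w * M)_{a,b} = Σ_{m<κ} Σ_{n<κ} w_{m,n} M_{a+m,b+n}` (0-based) corresponds
exactly to the 1-based definition in the paper.  The 1-based condition
`i − κ^1 − ⋯ − κ^l + l ≤ a ≤ i` becomes, in 0-based indices and ℕ-arithmetic,
`a ≤ i ∧ i ≤ a + (κ^1 + ⋯ + κ^l) − l`.  A 0-based output position `(a,b)` of
the iterated cross-correlation is valid iff `a + Σκ − l < H` and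
`b + Σκ − l < W`.
-/

/-- Valid cross-correlation of a `κ×κ` kernel `w` with a matrix `M` (0-based). -/
noncomputable def conv (κ : ℕ) (w M : ℕ → ℕ → ℝ) (a b : ℕ) : ℝ :=
  ∑ m ∈ Finset.range κ, ∑ n ∈ Finset.range κ, w m n * M (a + m) (b + n)

/-- Iterated valid cross-correlation: `iterConv κ w M l = w^l * (⋯ * (w^1 * M)⋯)`,
where the `r`-th applied kernel (0-based `r`) is `w r` of size `κ r`. -/
noncomputable def iterConv (κ : ℕ → ℕ) (w : ℕ → ℕ → ℕ → ℝ) (M : ℕ → ℕ → ℝ) :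
    ℕ → ℕ → ℕ → ℝ
  | 0 => M
  | r + 1 => conv (κ r) (w r) (iterConv κ w M r)

theorem iterConv_aux (κ : ℕ → ℕ) (w : ℕ → ℕ → ℕ → ℝ) (i j : ℕ)
    (E : ℕ → ℕ → ℝ) (hE : ∀ p q, E p q = if p = i ∧ q = j then 1 else 0) (l : ℕ) :
    ∀ a b : ℕ, ¬ ((a ≤ i ∧ i + l ≤ a + ∑ r ∈ Finset.range l, κ r) ∧
               (b ≤ j ∧ j + l ≤ b + ∑ r ∈ Finset.range l, κ r)) →
    iterConv κ w E l a b = 0 := by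
  induction l with
  | zero =>
    intro a b h
    simp only [iterConv, hE]
    rw [if_neg]
    rintro ⟨rfl, rfl⟩
    simp at h
  | succ l ih =>
    intro a b h
    simp only [iterConv, conv]
    refine Finset.sum_eq_zero fun m hm => Finset.sum_eq_zero fun n hn => ?_
    rw [ih, mul_zero]
    rw [Finset.sum_range_succ] at h
    rw [Finset.mem_range] at hm hn
    omega

/-- Outside the receptive-field window of the input pixel `(i,j)`, every entry
of the iterated cross-correlation of the kernels with the indicator matrix
`E^{(i,j)}` vanishes. -/
theorem iterConv_indicator_eq_zero_outside_window
    (l H W : ℕ) (κ : ℕ → ℕ) (hκ : ∀ r < l, 0 < κ r)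
    (w : ℕ → ℕ → ℕ → ℝ)
    (i j : ℕ) (hi : i < H) (hj : j < W)
    (E : ℕ → ℕ → ℝ) (hE : ∀ p q, E p q = if p = i ∧ q = j then 1 else 0)
    (a b : ℕ)
    (ha : a + (∑ r ∈ Finset.range l, κ r) - l < H)
    (hb : b + (∑ r ∈ Finset.range l, κ r) - l < W)
    (hout : ¬ ((a ≤ i ∧ i ≤ a + (∑ r ∈ Finset.range l, κ r) - l) ∧
               (b ≤ j ∧ j ≤ b + (∑ r ∈ Finset.range l, κ r) - l))) :
    iterConv κ w E l a b = 0 := by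
  apply iterConv_aux κ w i j E hE
  omega
end

section
/- Let σ : ℝ → ℝ be any function, let w^1, …, w^l be kernels with w^r ∈ ℝ^{κ^r × κ^r}, let b^1, …, b^l be bias matrices of matching sizes, and for X ∈ ℝ^{H×W} define Z^0(X) = X and Z^r(X) = w^r * σ(Z^{r−1}(X)) + b^r for r = 1, …, l (σ applied entrywise, all cross-correlations defined). Fix an input pixel (i,j) and an output position (a,b) of layer l such that it is NOT the case that both i − κ^1 − ⋯ − κ^l + l ≤ a ≤ i and j − κ^1 − ⋯ − κ^l + l ≤ b ≤ j. Then for every X ∈ ℝ^{H×W}, the function t ↦ σ(Z^l(X + t·E^{(i,j)})_{a,b}) is constant in t ∈ ℝ; in particular its derivative at every t is 0. Here E^{(i,j)} is the matrix with entry 1 at (i,j) and 0 elsewhere. -/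
/-- CNN layer outputs: `Zlayer σ κ w bias X r = Z^r(X)`, with `Z^0(X) = X` and
`Z^{r+1}(X) = w^{r+1} * σ(Z^r(X)) + b^{r+1}` (σ applied entrywise). -/
noncomputable def Zlayer (σ : ℝ → ℝ) (κ : ℕ → ℕ) (w : ℕ → ℕ → ℕ → ℝ)
    (bias : ℕ → ℕ → ℕ → ℝ) (X : ℕ → ℕ → ℝ) : ℕ → ℕ → ℕ → ℝ
  | 0 => X
  | r + 1 => fun a b =>
      conv (κ r) (w r) (fun p q => σ (Zlayer σ κ w bias X r p q)) a b + bias r a b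

theorem Zlayer_aux (σ : ℝ → ℝ) (κ : ℕ → ℕ) (w : ℕ → ℕ → ℕ → ℝ) (bias : ℕ → ℕ → ℕ → ℝ)
    (i j : ℕ) (X Y : ℕ → ℕ → ℝ) (hXY : ∀ p q, ¬ (p = i ∧ q = j) → X p q = Y p q) (l : ℕ) :
    (∀ r < l, 0 < κ r) → l ≤ (∑ r ∈ Finset.range l, κ r) ∧
    ∀ a b : ℕ, ¬ ((a ≤ i ∧ i ≤ a + (∑ r ∈ Finset.range l, κ r) - l) ∧
               (b ≤ j ∧ j ≤ b + (∑ r ∈ Finset.range l, κ r) - l)) →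
    Zlayer σ κ w bias X l a b = Zlayer σ κ w bias Y l a b := by
  induction l with
  | zero =>
    intro _
    refine ⟨by simp, fun a b h => ?_⟩
    simp only [Zlayer]
    apply hXY
    rintro ⟨rfl, rfl⟩
    simp at h
  | succ l ih =>
    intro hκ
    obtain ⟨h1, h2⟩ := ih (fun r hr => hκ r (by omega))
    have h3 := hκ l (by omega)
    rw [Finset.sum_range_succ]
    refine ⟨by omega, fun a b h => ?_⟩
    simp only [Zlayer, conv]
    congr 1
    refine Finset.sum_congr rfl fun m hm => Finset.sum_congr rfl fun n hn => ?_
    rw [Finset.mem_range] at hm hn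
    rw [h2 (a + m) (b + n) (by omega)]

/-- If the output position `(a,b)` of layer `l` lies outside the receptive-field
window of the input pixel `(i,j)`, then for every input `X` the function
`t ↦ σ(Z^l(X + t·E^{(i,j)})_{a,b})` is constant in `t`, and in particular its
derivative at every `t` is `0`. -/
theorem Zlayer_perturb_constant_outside_window
    (σ : ℝ → ℝ) (l H W : ℕ) (κ : ℕ → ℕ) (hκ : ∀ r < l, 0 < κ r)
    (w : ℕ → ℕ → ℕ → ℝ) (bias : ℕ → ℕ → ℕ → ℝ)
    (i j : ℕ) (hi : i < H) (hj : j < W)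
    (E : ℕ → ℕ → ℝ) (hE : ∀ p q, E p q = if p = i ∧ q = j then 1 else 0)
    (a b : ℕ)
    (ha : a + (∑ r ∈ Finset.range l, κ r) - l < H)
    (hb : b + (∑ r ∈ Finset.range l, κ r) - l < W)
    (hout : ¬ ((a ≤ i ∧ i ≤ a + (∑ r ∈ Finset.range l, κ r) - l) ∧
               (b ≤ j ∧ j ≤ b + (∑ r ∈ Finset.range l, κ r) - l)))
    (X : ℕ → ℕ → ℝ) :
    (∀ t₁ t₂ : ℝ,
        σ (Zlayer σ κ w bias (fun p q => X p q + t₁ * E p q) l a b) =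
        σ (Zlayer σ κ w bias (fun p q => X p q + t₂ * E p q) l a b)) ∧
    (∀ t : ℝ,
        HasDerivAt
          (fun s : ℝ => σ (Zlayer σ κ w bias (fun p q => X p q + s * E p q) l a b))
          0 t) := by
  have key : ∀ t₁ t₂ : ℝ,
        σ (Zlayer σ κ w bias (fun p q => X p q + t₁ * E p q) l a b) =
        σ (Zlayer σ κ w bias (fun p q => X p q + t₂ * E p q) l a b) := by
    intro t₁ t₂
    rw [(Zlayer_aux σ κ w bias i j (fun p q => X p q + t₁ * E p q)
      (fun p q => X p q + t₂ * E p q) (fun p q h => by simp [hE, h]) l hκ).2 a b hout]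
  refine ⟨key, fun t => ?_⟩
  exact (hasDerivAt_const t _).congr_of_eventuallyEq
    (Filter.Eventually.of_forall fun s => key s 0)
end

section
/- (Theorem 1, differentiable-activation form.) Let σ : ℝ → ℝ be differentiable, let w^1, …, w^l be kernels with w^r ∈ ℝ^{κ^r × κ^r}, let b^1, …, b^l be bias matrices of matching sizes, and for X ∈ ℝ^{H×W} define Z^0(X) = X and Z^r(X) = w^r * σ(Z^{r−1}(X)) + b^r for r = 1, …, l (σ applied entrywise, all cross-correlations defined). Fix an input X and an input pixel (i,j). Suppose that σ'(Z^l(X)_{a,b}) = 0 for every output position (a,b) of layer l satisfying i − κ^1 − ⋯ − κ^l + l ≤ a ≤ i and j − κ^1 − ⋯ − κ^l + l ≤ b ≤ j. Then for EVERY output position (a,b) of layer l, the derivative at t = 0 of t ↦ σ(Z^l(X + t·E^{(i,j)})_{a,b}) is 0; i.e., the input gradient of pixel (i,j) at layer l vanishes. -/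
theorem Zlayer_differentiable (σ : ℝ → ℝ) (hσ : Differentiable ℝ σ) (κ : ℕ → ℕ)
    (w : ℕ → ℕ → ℕ → ℝ) (bias : ℕ → ℕ → ℕ → ℝ) (X E : ℕ → ℕ → ℝ) (l : ℕ) :
    ∀ a b, Differentiable ℝ
      (fun t : ℝ => Zlayer σ κ w bias (fun p q => X p q + t * E p q) l a b) := by
  induction l with
  | zero => intro a b; simp only [Zlayer]; fun_prop
  | succ l ih =>
    intro a b
    simp only [Zlayer, conv]
    refine Differentiable.add_const _ (Differentiable.fun_sum fun m _ =>
      Differentiable.fun_sum fun n _ => Differentiable.const_mul ?_ _)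
    exact hσ.comp (ih (a + m) (b + n))

theorem Zlayer_const (σ : ℝ → ℝ) (κ : ℕ → ℕ)
    (w : ℕ → ℕ → ℕ → ℝ) (bias : ℕ → ℕ → ℕ → ℝ) (X E : ℕ → ℕ → ℝ) (i j : ℕ)
    (hE : ∀ p q, E p q = if p = i ∧ q = j then 1 else 0) (t : ℝ) (l : ℕ) :
    ∀ a b, (i < a ∨ a + (∑ r ∈ Finset.range l, κ r) < i + l ∨
        j < b ∨ b + (∑ r ∈ Finset.range l, κ r) < j + l) →
      Zlayer σ κ w bias (fun p q => X p q + t * E p q) l a b = Zlayer σ κ w bias X l a b := by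
  induction l with
  | zero =>
    intro a b h
    have : ¬ (a = i ∧ b = j) := by simp at h; omega
    simp [Zlayer, hE, this]
  | succ l ih =>
    intro a b h
    rw [Finset.sum_range_succ] at h
    simp only [Zlayer, conv]
    congr 1
    refine Finset.sum_congr rfl fun m hm => Finset.sum_congr rfl fun n hn => ?_
    rw [Finset.mem_range] at hm hn
    rw [ih (a + m) (b + n) (by omega)]

/-- Theorem 1 (differentiable-activation form): if `σ'(Z^l(X)_{a,b}) = 0` at
every output position `(a,b)` of layer `l` whose receptive field contains the
input pixel `(i,j)`, then the input gradient of pixel `(i,j)` at layer `l`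
vanishes at every output position of layer `l`. -/
theorem inputGradient_eq_zero_of_deriv_vanish_on_window
    (σ : ℝ → ℝ) (hσ : Differentiable ℝ σ)
    (l H W : ℕ) (κ : ℕ → ℕ) (hκ : ∀ r < l, 0 < κ r)
    (w : ℕ → ℕ → ℕ → ℝ) (bias : ℕ → ℕ → ℕ → ℝ)
    (X : ℕ → ℕ → ℝ) (i j : ℕ) (hi : i < H) (hj : j < W)
    (E : ℕ → ℕ → ℝ) (hE : ∀ p q, E p q = if p = i ∧ q = j then 1 else 0)
    (hvanish : ∀ a b,
      a + (∑ r ∈ Finset.range l, κ r) - l < H →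
      b + (∑ r ∈ Finset.range l, κ r) - l < W →
      (a ≤ i ∧ i ≤ a + (∑ r ∈ Finset.range l, κ r) - l) →
      (b ≤ j ∧ j ≤ b + (∑ r ∈ Finset.range l, κ r) - l) →
      deriv σ (Zlayer σ κ w bias X l a b) = 0) :
    ∀ a b,
      a + (∑ r ∈ Finset.range l, κ r) - l < H →
      b + (∑ r ∈ Finset.range l, κ r) - l < W →
      HasDerivAt
        (fun t : ℝ =>
          σ (Zlayer σ κ w bias (fun p q => X p q + t * E p q) l a b))
        0 0 := by
  intro a b ha hb
  by_cases h : (a ≤ i ∧ i ≤ a + (∑ r ∈ Finset.range l, κ r) - l) ∧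
      (b ≤ j ∧ j ≤ b + (∑ r ∈ Finset.range l, κ r) - l)
  · have h0 := hvanish a b ha hb h.1 h.2
    have hd := (Zlayer_differentiable σ hσ κ w bias X E l a b 0).hasDerivAt
    have hs := (hσ (Zlayer σ κ w bias (fun p q => X p q + 0 * E p q) l a b)).hasDerivAt
    have hc := HasDerivAt.comp (0 : ℝ) hs hd
    simp only [zero_mul, add_zero, h0] at hc
    exact hc
  · have hc : (fun t : ℝ => σ (Zlayer σ κ w bias (fun p q => X p q + t * E p q) l a b)) =
        fun _ => σ (Zlayer σ κ w bias X l a b) := by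
      funext t
      rw [Zlayer_const σ κ w bias X E i j hE t l a b (by omega)]
    rw [hc]
    exact hasDerivAt_const _ _
end

section
/- (Theorem 1, ReLU form.) Let σ : ℝ → ℝ be the ReLU function σ(z) = max(z, 0), let w^1, …, w^l be kernels with w^r ∈ ℝ^{κ^r × κ^r}, let b^1, …, b^l be bias matrices of matching sizes, and for X ∈ ℝ^{H×W} define Z^0(X) = X and Z^r(X) = w^r * σ(Z^{r−1}(X)) + b^r for r = 1, …, l (σ applied entrywise, all cross-correlations defined). Fix an input X and an input pixel (i,j). Suppose that Z^l(X)_{a,b} < 0 for every output position (a,b) of layer l satisfying i − κ^1 − ⋯ − κ^l + l ≤ a ≤ i and j − κ^1 − ⋯ − κ^l + l ≤ b ≤ j. Then for EVERY output position (a,b) of layer l, the function t ↦ σ(Z^l(X + t·E^{(i,j)})_{a,b}) is constant on some open neighbourhood of t = 0; in particular its derivative at t = 0 exists and equals 0, i.e., the input gradient of pixel (i,j) at layer l vanishes at X. -/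
theorem Zlayer_cont (σ : ℝ → ℝ) (hc : Continuous σ) (κ : ℕ → ℕ)
    (w bias : ℕ → ℕ → ℕ → ℝ) (X E : ℕ → ℕ → ℝ) (r : ℕ) : ∀ a b,
    Continuous (fun t : ℝ => Zlayer σ κ w bias (fun p q => X p q + t * E p q) r a b) := by
  induction r with
  | zero => intro a b; simp only [Zlayer]; fun_prop
  | succ r ih =>
    intro a b
    simp only [Zlayer, conv]
    refine Continuous.add (continuous_finsetSum _ fun m _ => continuous_finsetSum _ fun n _ => ?_)
      continuous_const
    exact continuous_const.mul (hc.comp (ih _ _))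

theorem Zlayer_indep (σ : ℝ → ℝ) (κ : ℕ → ℕ)
    (w bias : ℕ → ℕ → ℕ → ℝ) (X E : ℕ → ℕ → ℝ) (i j : ℕ)
    (hE : ∀ p q, E p q = if p = i ∧ q = j then 1 else 0) (t : ℝ) (r : ℕ) : ∀ a b,
    ¬ ((a ≤ i ∧ i + r ≤ a + ∑ s ∈ Finset.range r, κ s) ∧
       (b ≤ j ∧ j + r ≤ b + ∑ s ∈ Finset.range r, κ s)) →
    Zlayer σ κ w bias (fun p q => X p q + t * E p q) r a b = Zlayer σ κ w bias X r a b := by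
  induction r with
  | zero =>
    intro a b h
    have : ¬ (a = i ∧ b = j) := by
      rintro ⟨rfl, rfl⟩
      simp at h
    simp [Zlayer, hE, this]
  | succ r ih =>
    intro a b h
    simp only [Zlayer, conv]
    congr 1
    refine Finset.sum_congr rfl fun m hm => Finset.sum_congr rfl fun n hn => ?_
    rw [ih]
    rw [Finset.mem_range] at hm hn
    rw [Finset.sum_range_succ] at h
    omega

/-- Theorem 1 (ReLU form): if `Z^l(X)_{a,b} < 0` at every output position
`(a,b)` of layer `l` whose receptive field contains the input pixel `(i,j)`,
then at every output position of layer `l` the function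
`t ↦ ReLU(Z^l(X + t·E^{(i,j)})_{a,b})` is constant on an open neighbourhood of
`t = 0`; in particular its derivative at `t = 0` exists and equals `0`. -/
theorem relu_inputGradient_eq_zero_of_neg_on_window
    (σ : ℝ → ℝ) (hσ : ∀ z : ℝ, σ z = max z 0)
    (l H W : ℕ) (κ : ℕ → ℕ) (hκ : ∀ r < l, 0 < κ r)
    (w : ℕ → ℕ → ℕ → ℝ) (bias : ℕ → ℕ → ℕ → ℝ)
    (X : ℕ → ℕ → ℝ) (i j : ℕ) (hi : i < H) (hj : j < W)
    (E : ℕ → ℕ → ℝ) (hE : ∀ p q, E p q = if p = i ∧ q = j then 1 else 0)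
    (hneg : ∀ a b,
      a + (∑ r ∈ Finset.range l, κ r) - l < H →
      b + (∑ r ∈ Finset.range l, κ r) - l < W →
      (a ≤ i ∧ i ≤ a + (∑ r ∈ Finset.range l, κ r) - l) →
      (b ≤ j ∧ j ≤ b + (∑ r ∈ Finset.range l, κ r) - l) →
      Zlayer σ κ w bias X l a b < 0) :
    ∀ a b,
      a + (∑ r ∈ Finset.range l, κ r) - l < H →
      b + (∑ r ∈ Finset.range l, κ r) - l < W →
      (∃ ε > (0 : ℝ), ∀ t₁ t₂ : ℝ, |t₁| < ε → |t₂| < ε →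
          σ (Zlayer σ κ w bias (fun p q => X p q + t₁ * E p q) l a b) =
          σ (Zlayer σ κ w bias (fun p q => X p q + t₂ * E p q) l a b)) ∧
      HasDerivAt
        (fun t : ℝ =>
          σ (Zlayer σ κ w bias (fun p q => X p q + t * E p q) l a b))
        0 0 := by
  intro a b ha hb
  have hc : Continuous σ := by
    have : σ = fun z => max z 0 := funext hσ
    rw [this]; fun_prop
  have hS : l ≤ ∑ r ∈ Finset.range l, κ r := by
    have := Finset.sum_le_sum (s := Finset.range l) (f := fun _ => 1) (g := κ)
      (fun r hr => hκ r (Finset.mem_range.1 hr))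
    simpa using this
  have key : ∃ c : ℝ, ∀ᶠ t : ℝ in nhds 0,
      σ (Zlayer σ κ w bias (fun p q => X p q + t * E p q) l a b) = c := by
    by_cases h : ((a ≤ i ∧ i + l ≤ a + ∑ s ∈ Finset.range l, κ s) ∧
       (b ≤ j ∧ j + l ≤ b + ∑ s ∈ Finset.range l, κ s))
    · have hn := hneg a b ha hb (by omega) (by omega)
      refine ⟨0, ?_⟩
      have hev := (Zlayer_cont σ hc κ w bias X E l a b).continuousAt (x := 0)
        |>.eventually_lt (continuousAt_const (y := (0 : ℝ))) (by simpa using hn)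
      filter_upwards [hev] with t ht
      rw [hσ]
      exact max_eq_right ht.le
    · exact ⟨_, Filter.Eventually.of_forall fun t => by
        rw [Zlayer_indep σ κ w bias X E i j hE t l a b h]⟩
  obtain ⟨c, hev⟩ := key
  constructor
  · obtain ⟨ε, hε, h⟩ := Metric.eventually_nhds_iff.1 hev
    refine ⟨ε, hε, fun t₁ t₂ h₁ h₂ => ?_⟩
    rw [h (by simpa [Real.dist_eq] using h₁), h (by simpa [Real.dist_eq] using h₂)]
  · exact (hasDerivAt_const (0 : ℝ) c).congr_of_eventuallyEq hev
end
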